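/- Let p and r be real numbers with p ≠ 0 and 0 < r < 2*|p|, and let g(x,y,p,r) be the polynomial defined in the context. Then the only real point (x,y) satisfying g(x,y,p,r) = 0, (∂g/∂x)(x,y,p,r) = 0 and (∂g/∂y)(x,y,p,r) = 0 (partial derivatives taken with respect to x and y) is (x,y) = (0, p + r^2/(4*p)). In particular, for offsets below the critical value r_crit = 2*|p| the variety V(g) has exactly one real singular point, the virtual singular point S1 = (0, p + r^2/(4*p)). -/

import Mathlib

/-- The degree-six polynomial defining the parallel lines to the parabola 4*p*y = x^2
at offset r. -/
noncomputable def gPar (x y p r : ℝ) : ℝ :=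
  -2*p*r^2*y*x^2 + 8*p*r^2*y^3 + 8*p^2*r^2*y^2 - 32*y*p^3*r^2 + 16*p^4*r^2 - 16*y^4*p^2 +
    32*y^3*p^3 - 16*p^4*y^2 + 3*r^2*x^4 + 8*p^2*r^4 + 20*p^2*r^2*x^2 - y^2*x^4 + 10*y*p*x^4 -
    x^6 - x^4*p^2 + 8*p*y^3*x^2 - 32*x^2*y^2*p^2 + 8*x^2*y*p^3 - 3*r^4*x^2 + 2*r^2*x^2*y^2 +
    r^6 - r^4*y^2 - 8*p*r^4*y

/-- Discriminant of the depressed quartic `t^4 + q t^2 + s t + u`. -/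
def discD (q s u : ℝ) : ℝ :=
  256*u^3 - 128*q^2*u^2 + 144*q*s^2*u - 27*s^4 + 16*q^4*u - 4*q^3*s^2

/-- Partial derivatives of the discriminant. -/
def discU (q s u : ℝ) : ℝ := 768*u^2 - 256*q^2*u + 144*q*s^2 + 16*q^4

def discS (q s u : ℝ) : ℝ := 288*q*s*u - 108*s^3 - 8*q^3*s

def discQ (q s u : ℝ) : ℝ := -256*q*u^2 + 144*s^2*u + 64*q^3*u - 12*q^2*s^2

/-- The normalised statement (`p = 1`), in terms of the discriminant. -/
lemma norm_case (X Y R q s u : ℝ) (hR : R ≠ 0) (hR4 : R^2 < 4)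
    (hq : q = 4 - 2*Y) (hs : s = -4*X) (hu : u = X^2 + Y^2 - R^2)
    (h0 : discD q s u = 0) (h1 : X * discU q s u - 2 * discS q s u = 0)
    (h2 : Y * discU q s u - discQ q s u = 0) : X = 0 := by
  by_contra hX
  have hR2 : 0 < R^2 := by positivity
  have hX2 : 0 < X^2 := by positivity
  have euler : 2*q*discQ q s u + 3*s*discS q s u + 4*u*discU q s u = 12 * discD q s u := by
    unfold discQ discS discU discD; ring
  have hess : discQ q s u * discU q s u - discS q s u ^ 2
      = discD q s u * (64*q^3 - 768*q*u + 432*s^2) := by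
    unfold discQ discS discU discD; ring
  have eS : discS q s u = X * discU q s u / 2 := by linarith
  have eQ : discQ q s u = Y * discU q s u := by linarith
  have hU : discU q s u = 0 := by
    by_contra hU
    rw [h0, eS, eQ] at euler hess
    have a1 : discU q s u * (8*Y - 2*X^2 - 4*R^2) = 0 := by
      rw [hq, hs, hu] at euler ⊢
      linear_combination euler
    have a2 : discU q s u ^ 2 * (Y - X^2/4) = 0 := by linear_combination hess
    have b1 := (mul_eq_zero.mp a1).resolve_left hU
    have b2 := (mul_eq_zero.mp a2).resolve_left (pow_ne_zero 2 hU)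
    linarith
  have hs0 : s ≠ 0 := by rw [hs]; simpa using hX
  have c1 : s * (288*q*u - 108*s^2 - 8*q^3) = 0 := by
    rw [hU] at eS; unfold discS at eS; linear_combination eS
  have c2 := (mul_eq_zero.mp c1).resolve_left hs0
  have c3 : (12*u + q^2)^2 = 0 := by
    unfold discU at hU; linear_combination (3/16) * hU + (q/4) * c2
  have c4 : 12*u + q^2 = 0 := pow_eq_zero_iff (two_ne_zero) |>.mp c3
  have c5 : 27*X^2 = 4*(Y-2)^3 := by
    have : 27*s^2 = -8*q^3 := by linear_combination (-1/4)*c2 + 6*q*c4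
    rw [hq, hs] at this
    linear_combination this/16
  have hY : 0 < Y - 2 := by
    by_contra h
    have : (Y-2)^3 ≤ 0 := Odd.pow_nonpos (by decide) (by linarith)
    linarith
  rw [hq, hu] at c4
  nlinarith

theorem parabola_unique_singular_point_subcritical (p r : ℝ) (hp : p ≠ 0)
    (hr0 : 0 < r) (hr : r < 2*|p|) :
    ∀ x y : ℝ,
      (gPar x y p r = 0 ∧
       deriv (fun t : ℝ => gPar t y p r) x = 0 ∧
       deriv (fun t : ℝ => gPar x t p r) y = 0)
      ↔ (x = 0 ∧ y = p + r^2/(4*p)) := by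
  intro x y
  have hx' : ∀ t, HasDerivAt (fun t : ℝ => gPar t y p r)
      (-4*p*r^2*y*t + 12*r^2*t^3 + 40*p^2*r^2*t - 4*y^2*t^3 + 40*y*p*t^3 - 6*t^5 - 4*t^3*p^2
        + 16*p*y^3*t - 64*t*y^2*p^2 + 16*t*y*p^3 - 6*r^4*t + 4*r^2*t*y^2) t := by
    intro t
    let P : Polynomial ℝ := .C (-1) * .X^6
      + .C (3*r^2 - y^2 + 10*y*p - p^2) * .X^4
      + .C (-2*p*r^2*y + 20*p^2*r^2 + 8*p*y^3 - 32*y^2*p^2 + 8*y*p^3 - 3*r^4 + 2*r^2*y^2) * .X^2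
      + .C (gPar 0 y p r)
    have h := P.hasDerivAt t
    have e : (fun t : ℝ => gPar t y p r) = fun t => P.eval t := by
      funext t; simp [P, gPar]; ring
    rw [e]
    refine h.congr_deriv ?_
    simp [P, Polynomial.derivative_pow]; ring
  have hy' : ∀ t, HasDerivAt (fun t : ℝ => gPar x t p r)
      (-2*p*r^2*x^2 + 24*p*r^2*t^2 + 16*p^2*r^2*t - 32*p^3*r^2 - 64*t^3*p^2 + 96*t^2*p^3
        - 32*p^4*t - 2*t*x^4 + 10*p*x^4 + 24*p*t^2*x^2 - 64*x^2*t*p^2 + 8*x^2*p^3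
        + 4*r^2*x^2*t - 2*r^4*t - 8*p*r^4) t := by
    intro t
    let P : Polynomial ℝ := .C (-16*p^2) * .X^4
      + .C (8*p*r^2 + 32*p^3 + 8*p*x^2) * .X^3
      + .C (8*p^2*r^2 - 16*p^4 - x^4 - 32*x^2*p^2 + 2*r^2*x^2 - r^4) * .X^2
      + .C (-2*p*r^2*x^2 - 32*p^3*r^2 + 10*p*x^4 + 8*x^2*p^3 - 8*p*r^4) * .X
      + .C (gPar x 0 p r)
    have h := P.hasDerivAt t
    have e : (fun t : ℝ => gPar x t p r) = fun t => P.eval t := by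
      funext t; simp [P, gPar]; ring
    rw [e]
    refine h.congr_deriv ?_
    simp [P, Polynomial.derivative_pow]; ring
  rw [(hx' x).deriv, (hy' y).deriv]
  have hrp : r^2 < 4*p^2 := by
    have := sq_abs p
    nlinarith [abs_nonneg p]
  constructor
  · rintro ⟨h0, h1, h2⟩
    have hx0 : x = 0 := by
      obtain ⟨X, rfl⟩ : ∃ X, x = p*X := ⟨x/p, by field_simp⟩
      obtain ⟨Y, rfl⟩ : ∃ Y, y = p*Y := ⟨y/p, by field_simp⟩
      obtain ⟨R, rfl⟩ : ∃ R, r = p*R := ⟨r/p, by field_simp⟩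
      have hp2 : 0 < p^2 := by positivity
      have hX : X = 0 := by
        refine norm_case X Y R _ _ _ (right_ne_zero_of_mul hr0.ne') (by nlinarith) rfl rfl rfl
          ?_ ?_ ?_
        · apply (mul_eq_zero.mp (?_ : p^6 * _ = 0)).resolve_left (pow_ne_zero 6 hp)
          unfold gPar at h0; unfold discD
          linear_combination (-256) * h0
        · apply (mul_eq_zero.mp (?_ : p^5 * _ = 0)).resolve_left (pow_ne_zero 5 hp)
          unfold discU discS
          linear_combination (-128) * h1
        · apply (mul_eq_zero.mp (?_ : p^5 * _ = 0)).resolve_left (pow_ne_zero 5 hp)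
          unfold discU discQ
          linear_combination (-128) * h2
      rw [hX, mul_zero]
    subst hx0
    refine ⟨rfl, ?_⟩
    have hA : 4*p*y - 4*p^2 - r^2 = 0 := by
      by_contra hA
      have e0 : (r^2 - y^2) * (4*p*y - 4*p^2 - r^2)^2 = 0 := by
        unfold gPar at h0; linear_combination h0
      have e1 := (mul_eq_zero.mp e0).resolve_right (pow_ne_zero 2 hA)
      have e2 : y * (4*p*y - 4*p^2 - r^2)^2 = 0 := by
        linear_combination (-1/2) * h2 + 4*p*(4*p*y - 4*p^2 - r^2) * e1
      have e3 := (mul_eq_zero.mp e2).resolve_right (pow_ne_zero 2 hA)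
      rw [e3] at e1
      nlinarith
    field_simp
    linear_combination hA
  · rintro ⟨rfl, rfl⟩
    refine ⟨?_, ?_, ?_⟩
    · unfold gPar; field_simp; ring
    · ring
    · field_simp; ring
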